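/- arXiv:2507.13672 — 6 statements merged into one kernel-verified Lean document; each statement's English description precedes it below -/
import Mathlib

section
/- Let E = ℝ³ with the Euclidean inner product, let e_h ≥ 0, e_{∇h} ≥ 0 and α > 0 be real constants. Let h, h̃ : E → ℝ be differentiable functions (with gradients ∇h, ∇h̃) such that for every x ∈ E: h(x) ≥ h̃(x) − e_h and ‖∇h(x) − ∇h̃(x)‖ ≤ e_{∇h}. Let r : ℝ → E be differentiable and suppose that for every t ≥ 0 the velocity r′(t) satisfies the robustified CBF constraint ⟪∇h̃(r(t)), r′(t)⟫ − e_{∇h}·‖r′(t)‖ ≥ −α·(h̃(r(t)) − e_h). If h(r(0)) ≥ 0, then h(r(t)) ≥ 0 for all t ≥ 0. -/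
open RealInnerProductSpace

/-- If `f' ≥ -a f` on `[0, ∞)` and `f 0 ≥ 0`, then `f` stays nonnegative. -/
theorem nonneg_of_neg_mul_le_deriv {a : ℝ} {f f' : ℝ → ℝ} (hf : ∀ t, HasDerivAt f (f' t) t)
    (hle : ∀ t, 0 ≤ t → -(a * f t) ≤ f' t) (h0 : 0 ≤ f 0) {t : ℝ} (ht : 0 ≤ t) : 0 ≤ f t := by
  have hg (s : ℝ) : HasDerivAt (fun u => Real.exp (a * u) * f u)
      (Real.exp (a * s) * (a * f s + f' s)) s :=
    (((hasDerivAt_id s).const_mul a).exp.mul (hf s)).congr_deriv (by simp only [id]; ring)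
  have hmono : MonotoneOn (fun u => Real.exp (a * u) * f u) (Set.Ici 0) := by
    refine monotoneOn_of_deriv_nonneg (convex_Ici 0)
      (fun s _ => (hg s).continuousAt.continuousWithinAt)
      (fun s _ => (hg s).differentiableAt.differentiableWithinAt) fun s hs => ?_
    rw [(hg s).deriv]
    exact mul_nonneg (Real.exp_pos _).le (by linarith [hle s (interior_subset hs)])
  have key := hmono Set.self_mem_Ici ht ht
  simp only [mul_zero, Real.exp_zero, one_mul] at key
  exact nonneg_of_mul_nonneg_right (h0.trans key) (Real.exp_pos _)

theorem stmt_3 (e_h e_gh a : ℝ) (h_eh : 0 ≤ e_h) (h_egh : 0 ≤ e_gh) (ha : 0 < a)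
    (h ht : EuclideanSpace ℝ (Fin 3) → ℝ)
    (hdiff : Differentiable ℝ h) (htdiff : Differentiable ℝ ht)
    (hval : ∀ x, h x ≥ ht x - e_h)
    (hgrad : ∀ x, ‖gradient h x - gradient ht x‖ ≤ e_gh)
    (r : ℝ → EuclideanSpace ℝ (Fin 3)) (hr : Differentiable ℝ r)
    (hcbf : ∀ t : ℝ, 0 ≤ t →
      ⟪gradient ht (r t), deriv r t⟫ - e_gh * ‖deriv r t‖ ≥ -(a * (ht (r t) - e_h)))
    (h0 : h (r 0) ≥ 0) :
    ∀ t : ℝ, 0 ≤ t → h (r t) ≥ 0 := by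
  intro t t_nonneg
  have hderiv (s : ℝ) : HasDerivAt (fun u => h (r u)) ⟪gradient h (r s), deriv r s⟫ s :=
    (hdiff (r s)).hasGradientAt.hasFDerivAt.comp_hasDerivAt s (hr s).hasDerivAt
  refine nonneg_of_neg_mul_le_deriv (a := a) hderiv (fun s hs => ?_) h0 t_nonneg
  have herr : -(e_gh * ‖deriv r s‖) ≤ ⟪gradient h (r s) - gradient ht (r s), deriv r s⟫ :=
    neg_le_of_abs_le ((abs_real_inner_le_norm _ _).trans
      (mul_le_mul_of_nonneg_right (hgrad (r s)) (norm_nonneg _)))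
  rw [inner_sub_left] at herr
  have hmul := mul_le_mul_of_nonneg_left (hval (r s)) ha.le
  linarith [hcbf s hs]
end

section
/- Let A, C, Φ be 3×3 real matrices, m > 0 a real number, and let ξ, z, r, v, F, f : ℝ → ℝ³ be differentiable functions satisfying: ξ′(t) = A·ξ(t) (disturbance model, with disturbance d(t) = C·ξ(t)); v′(t) = f(t) + (1/m)·(F(t) + C·ξ(t)) (relative translational dynamics with known drift f and control force F); and z′(t) = (A − (1/m)·Φ·C)·z(t) + A·(Φ·v(t)) − Φ·((1/m)·C·(Φ·v(t)) + f(t) + (1/m)·F(t)) (observer internal state). Define the estimate ξ̂(t) = z(t) + Φ·v(t) and the estimation error e(t) = ξ(t) − ξ̂(t). Then e is differentiable and e′(t) = (A − (1/m)·Φ·C)·e(t) for all t. -/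
theorem stmt_5 (A C Φ : Matrix (Fin 3) (Fin 3) ℝ) (m : ℝ) (hm : 0 < m)
    (ξ z r v F f : ℝ → (Fin 3 → ℝ))
    (hξ : Differentiable ℝ ξ) (hz : Differentiable ℝ z)
    (hr : Differentiable ℝ r) (hv : Differentiable ℝ v)
    (hF : Differentiable ℝ F) (hf : Differentiable ℝ f)
    (hξd : ∀ t, deriv ξ t = A.mulVec (ξ t))
    (hvd : ∀ t, deriv v t = f t + (1/m) • (F t + C.mulVec (ξ t)))
    (hzd : ∀ t, deriv z t =
      (A - (1/m) • (Φ * C)).mulVec (z t) + A.mulVec (Φ.mulVec (v t))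
        - Φ.mulVec ((1/m) • C.mulVec (Φ.mulVec (v t)) + f t + (1/m) • F t)) :
    Differentiable ℝ (fun t => ξ t - (z t + Φ.mulVec (v t))) ∧
    ∀ t, deriv (fun t => ξ t - (z t + Φ.mulVec (v t))) t =
      (A - (1/m) • (Φ * C)).mulVec (ξ t - (z t + Φ.mulVec (v t))) := by
  have hΦv : ∀ t, HasDerivAt (fun t => Φ.mulVec (v t)) (Φ.mulVec (deriv v t)) t := fun t =>
    (Matrix.mulVecLin Φ).toContinuousLinearMap.hasFDerivAt.comp_hasDerivAt t (hv t).hasDerivAt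
  have he : ∀ t, HasDerivAt (fun t => ξ t - (z t + Φ.mulVec (v t)))
      (deriv ξ t - (deriv z t + Φ.mulVec (deriv v t))) t := fun t =>
    (hξ t).hasDerivAt.sub ((hz t).hasDerivAt.add (hΦv t))
  refine ⟨fun t => (he t).differentiableAt, fun t => ?_⟩
  rw [(he t).deriv, hξd, hzd, hvd]
  simp only [Matrix.mulVec_add, Matrix.mulVec_sub, Matrix.sub_mulVec, Matrix.smul_mulVec,
    Matrix.mulVec_smul, ← Matrix.mulVec_mulVec, smul_add]
  abel
end

section
/- Let n be a natural number, let P, u_ref ∈ ℝⁿ (Euclidean inner product and norm), let c ∈ ℝ and ε > 0. Define a := ⟪P, u_ref⟫ + c, and Λ := 0 if P = 0, and Λ := (1/ε)·log(1 + exp(−ε·a/‖P‖²)) otherwise. Assume that c ≥ 0 whenever P = 0. Then the filtered input u := u_ref + Λ·P satisfies ⟪P, u⟫ + c ≥ 0. -/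
open RealInnerProductSpace
open scoped Classical

/-- The softplus function dominates the identity. -/
theorem le_log_one_add_exp (x : ℝ) : x ≤ Real.log (1 + Real.exp x) := by
  rw [Real.le_log_iff_exp_le (by positivity)]
  linarith

theorem stmt_10 (n : ℕ) (P u_ref : EuclideanSpace ℝ (Fin n)) (c ε : ℝ) (hε : 0 < ε)
    (hc : P = 0 → 0 ≤ c) :
    ⟪P, u_ref + (if P = 0 then (0 : ℝ) else
        (1 / ε) * Real.log (1 + Real.exp (-ε * (⟪P, u_ref⟫ + c) / ‖P‖ ^ 2))) • P⟫ + c ≥ 0 := by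
  by_cases hP : P = 0
  · simpa [hP] using hc hP
  · have hb : 0 < ‖P‖ ^ 2 := by positivity
    rw [if_neg hP, inner_add_right, real_inner_smul_right, real_inner_self_eq_norm_sq]
    set a := ⟪P, u_ref⟫ + c with ha
    have key := mul_le_mul_of_nonneg_left (le_log_one_add_exp (-ε * a / ‖P‖ ^ 2))
      (by positivity : 0 ≤ 1 / ε * ‖P‖ ^ 2)
    have hcancel : 1 / ε * ‖P‖ ^ 2 * (-ε * a / ‖P‖ ^ 2) = -a := by field_simp
    linarith
end

section
/- Let E = ℝ³ with the Euclidean inner product. Let m > 0, μ_h > 0, β > 0, e_h ≥ 0, e_{∇h} ≥ 0 and β_c, β_e be real with 0 < β_c < 2β_e. Let h, h̃ : E → ℝ be differentiable with h(x) ≥ h̃(x) − e_h and ‖∇h(x) − ∇h̃(x)‖ ≤ e_{∇h} for all x. Let v_s : E → E be differentiable with Fréchet derivative Dv_s. Let r, v, e_d, u, g : ℝ → E be functions with r, v, e_d differentiable, and let C₁, C₂ : ℝ → (E →L E) be time-varying linear maps, such that for all t: r′(t) = v(t); v′(t) = −C₁(t)(v(t)) − C₂(t)(r(t)) + g(t)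 + (1/m)·(u(t) + e_d(t)); ⟪e_d(t), e_d′(t)⟫ ≤ −β_e·‖e_d(t)‖²; and the control input satisfies (1/(m·μ_h))·⟪v(t) − v_s(r(t)), u(t)⟫ ≤ ⟪∇h̃(r(t)), v(t)⟫ − e_{∇h}·‖v(t)‖ + (1/μ_h)·⟪v(t) − v_s(r(t)), C₁(t)(v(t)) + C₂(t)(r(t)) − g(t) + Dv_s(r(t))(v(t))⟫ + β_c·(h̃(r(t)) − e_h − (1/(2μ_h))·‖v(t) − v_s(r(t))‖²) − (1/(2β·(2β_e − β_c)))·‖(1/(m·μ_h))·(v(t) − v_s(r(t)))‖². Define h₁(t) := h(r(t)) − (1/(2μ_h))·‖v(t) − v_s(r(t))‖² − (β/2)·‖e_d(t)‖². Then h₁ is differentiable with h₁′(t) ≥ −β_c·h₁(t) for all t, and if h₁(0) ≥ 0 then h₁(t) ≥ 0 for all t ≥ 0. -/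
open RealInnerProductSpace

/-- A weighted Young inequality, obtained by completing the square. -/
lemma inner_le_weighted_norm_sq {E : Type*} [NormedAddCommGroup E] [InnerProductSpace ℝ E]
    {a : ℝ} (ha : 0 < a) (x y : E) :
    ⟪x, y⟫ ≤ 1 / (2 * a) * ‖x‖ ^ 2 + a / 2 * ‖y‖ ^ 2 := by
  have hsq : 1 / (2 * a) * (‖x‖ - a * ‖y‖) ^ 2
      = 1 / (2 * a) * ‖x‖ ^ 2 + a / 2 * ‖y‖ ^ 2 - ‖x‖ * ‖y‖ := by
    field_simp
    ring
  have hnonneg : 0 ≤ 1 / (2 * a) * (‖x‖ - a * ‖y‖) ^ 2 := by positivity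
  linarith [real_inner_le_norm x y]

/-- A differential inequality `f' ≥ -c f` preserves nonnegativity forward in time. -/
lemma nonneg_of_neg_mul_le_deriv_s11 {f : ℝ → ℝ} {c : ℝ} (hf : Differentiable ℝ f)
    (hderiv : ∀ t, -c * f t ≤ deriv f t) {a t : ℝ} (ha : 0 ≤ f a) (hat : a ≤ t) :
    0 ≤ f t := by
  have hd : ∀ s, HasDerivAt (fun s => Real.exp (c * s) * f s)
      (Real.exp (c * s) * (c * 1) * f s + Real.exp (c * s) * deriv f s) s := fun s =>
    (((hasDerivAt_id s).const_mul c).exp).mul (hf s).hasDerivAt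
  have hmono : Monotone fun s => Real.exp (c * s) * f s := by
    refine monotone_of_deriv_nonneg (fun s => (hd s).differentiableAt) fun s => ?_
    rw [(hd s).deriv]
    have : 0 ≤ Real.exp (c * s) * (c * f s + deriv f s) :=
      mul_nonneg (Real.exp_pos _).le (by linarith [hderiv s])
    linarith
  have hle : Real.exp (c * a) * f a ≤ Real.exp (c * t) * f t := hmono hat
  exact nonneg_of_mul_nonneg_right
    ((mul_nonneg (Real.exp_pos _).le ha).trans hle) (Real.exp_pos _)

theorem stmt_11
    (m μ_h β e_h e_gh β_c β_e : ℝ)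
    (hm : 0 < m) (hμh : 0 < μ_h) (hβ : 0 < β) (h_eh : 0 ≤ e_h) (h_egh : 0 ≤ e_gh)
    (hβc : 0 < β_c) (hβcβe : β_c < 2 * β_e)
    (h ht : EuclideanSpace ℝ (Fin 3) → ℝ)
    (hdiff : Differentiable ℝ h) (htdiff : Differentiable ℝ ht)
    (hval : ∀ x, h x ≥ ht x - e_h)
    (hgrad : ∀ x, ‖gradient h x - gradient ht x‖ ≤ e_gh)
    (vs : EuclideanSpace ℝ (Fin 3) → EuclideanSpace ℝ (Fin 3)) (hvs : Differentiable ℝ vs)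
    (r v e_d u g : ℝ → EuclideanSpace ℝ (Fin 3))
    (hr : Differentiable ℝ r) (hv : Differentiable ℝ v) (hed : Differentiable ℝ e_d)
    (C₁ C₂ : ℝ → (EuclideanSpace ℝ (Fin 3) →L[ℝ] EuclideanSpace ℝ (Fin 3)))
    (hrd : ∀ t, deriv r t = v t)
    (hvd : ∀ t, deriv v t =
      -(C₁ t (v t)) - C₂ t (r t) + g t + (1 / m) • (u t + e_d t))
    (hedd : ∀ t, ⟪e_d t, deriv e_d t⟫ ≤ -β_e * ‖e_d t‖ ^ 2)
    (hu : ∀ t, (1 / (m * μ_h)) * ⟪v t - vs (r t), u t⟫ ≤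
      ⟪gradient ht (r t), v t⟫ - e_gh * ‖v t‖
      + (1 / μ_h) * ⟪v t - vs (r t),
          C₁ t (v t) + C₂ t (r t) - g t + fderiv ℝ vs (r t) (v t)⟫
      + β_c * (ht (r t) - e_h - (1 / (2 * μ_h)) * ‖v t - vs (r t)‖ ^ 2)
      - (1 / (2 * β * (2 * β_e - β_c))) * ‖(1 / (m * μ_h)) • (v t - vs (r t))‖ ^ 2) :
    ∀ h₁ : ℝ → ℝ,
      h₁ = (fun t => h (r t) - (1 / (2 * μ_h)) * ‖v t - vs (r t)‖ ^ 2
        - (β / 2) * ‖e_d t‖ ^ 2) →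
      Differentiable ℝ h₁ ∧ (∀ t, deriv h₁ t ≥ -β_c * h₁ t) ∧
      (h₁ 0 ≥ 0 → ∀ t : ℝ, 0 ≤ t → h₁ t ≥ 0) := by
  rintro h₁ rfl
  have hd : ∀ t, HasDerivAt (fun t => h (r t) - (1 / (2 * μ_h)) * ‖v t - vs (r t)‖ ^ 2
        - (β / 2) * ‖e_d t‖ ^ 2)
      (⟪gradient h (r t), v t⟫
        - (1 / (2 * μ_h)) * (2 * ⟪v t - vs (r t), deriv v t - fderiv ℝ vs (r t) (v t)⟫)
        - (β / 2) * (2 * ⟪e_d t, deriv e_d t⟫)) t := by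
    intro t
    have hr' : HasDerivAt r (v t) t := hrd t ▸ (hr t).hasDerivAt
    have hh : HasDerivAt (fun t => h (r t)) ⟪gradient h (r t), v t⟫ t := by
      have := (hdiff (r t)).hasGradientAt.hasFDerivAt.comp_hasDerivAt t hr'
      simpa [Function.comp_def] using this
    have hw := (hv t).hasDerivAt.sub ((hvs (r t)).hasFDerivAt.comp_hasDerivAt t hr')
    exact (hh.sub (hw.norm_sq.const_mul _)).sub ((hed t).hasDerivAt.norm_sq.const_mul _)
  have hdiff₁ : Differentiable ℝ fun t => h (r t) - (1 / (2 * μ_h)) * ‖v t - vs (r t)‖ ^ 2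
      - (β / 2) * ‖e_d t‖ ^ 2 := fun t => (hd t).differentiableAt
  have hderiv : ∀ t, deriv (fun t => h (r t) - (1 / (2 * μ_h)) * ‖v t - vs (r t)‖ ^ 2
      - (β / 2) * ‖e_d t‖ ^ 2) t ≥ -β_c * (h (r t) - (1 / (2 * μ_h)) * ‖v t - vs (r t)‖ ^ 2
      - (β / 2) * ‖e_d t‖ ^ 2) := by
    intro t
    rw [(hd t).deriv, hvd t]
    have hgap : 0 < β * (2 * β_e - β_c) := mul_pos hβ (sub_pos.2 hβcβe)
    have hyoung := inner_le_weighted_norm_sq hgap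
      ((1 / (m * μ_h)) • (v t - vs (r t))) (e_d t)
    rw [real_inner_smul_left, ← mul_assoc 2 β] at hyoung
    have hgv : ⟪gradient ht (r t), v t⟫ - e_gh * ‖v t‖ ≤ ⟪gradient h (r t), v t⟫ := by
      have hcs := neg_le_of_abs_le
        (abs_real_inner_le_norm (gradient h (r t) - gradient ht (r t)) (v t))
      have hbound := mul_le_mul_of_nonneg_right (hgrad (r t)) (norm_nonneg (v t))
      rw [inner_sub_left] at hcs
      linarith
    have hval' := mul_le_mul_of_nonneg_left (hval (r t)) hβc.le
    have hed' := mul_le_mul_of_nonneg_left (hedd t) hβ.le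
    have hsplit : -(C₁ t (v t)) - C₂ t (r t) + g t + (1 / m) • (u t + e_d t)
        - fderiv ℝ vs (r t) (v t)
        = (1 / m) • (u t + e_d t)
          - (C₁ t (v t) + C₂ t (r t) - g t + fderiv ℝ vs (r t) (v t)) := by abel
    have hinner : 1 / (2 * μ_h) * (2 * ⟪v t - vs (r t),
          -(C₁ t (v t)) - C₂ t (r t) + g t + (1 / m) • (u t + e_d t)
            - fderiv ℝ vs (r t) (v t)⟫)
        = 1 / (m * μ_h) * ⟪v t - vs (r t), u t⟫ + 1 / (m * μ_h) * ⟪v t - vs (r t), e_d t⟫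
          - 1 / μ_h * ⟪v t - vs (r t),
              C₁ t (v t) + C₂ t (r t) - g t + fderiv ℝ vs (r t) (v t)⟫ := by
      rw [hsplit, inner_sub_right, real_inner_smul_right, inner_add_right _ (u t)]
      field_simp
    rw [hinner]
    linarith [hu t]
  exact ⟨hdiff₁, hderiv, fun h0 t ht0 => nonneg_of_neg_mul_le_deriv_s11 hdiff₁ hderiv h0 ht0⟩
end

section
/- Let E = ℝ³ with the Euclidean inner product, let H₀ be a symmetric 3×3 real matrix, let m > 0, μ_v > 0 and λ be real numbers, and let r_d ∈ E. Let v_s : E → E be differentiable with Fréchet derivative Dv_s, let C₁, C₂ : ℝ → (E →L E) be time-varying linear maps, g : ℝ → E a function, and let r, v : ℝ → E be differentiable with r′(t) = v(t) and v′(t) = −C₁(t)(v(t)) − C₂(t)(r(t)) + g(t) + (1/m)·u_ref(t), where u_ref(t) := m·(C₁(t)(v(t)) + C₂(t)(r(t)) − g(t) + Dv_s(r(t))(v(t)) − μ_v·H₀·(r(t) − r_d) − (λ/2)·(v(t) − v_s(r(t)))). Define V₁(t) := (1/2)·⟪r(t) − r_d, H₀·(r(t) − r_d)⟫ + (1/(2μ_v))·‖v(t)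 − v_s(r(t))‖². Then V₁ is differentiable and V₁′(t) = ⟪r(t) − r_d, H₀·(v_s(r(t)))⟫ − (λ/(2μ_v))·‖v(t) − v_s(r(t))‖² for all t. -/
open RealInnerProductSpace

/-- Derivative of the energy `½⟪e, A e⟫ + (2μ)⁻¹‖w‖²` along backstepping error dynamics. -/
theorem hasDerivAt_backstepping_energy {E : Type*} [NormedAddCommGroup E]
    [InnerProductSpace ℝ E] {A : E →L[ℝ] E} (hA : (A : E →ₗ[ℝ] E).IsSymmetric)
    {mu lam : ℝ} (hmu : mu ≠ 0) {e w : ℝ → E} {e' : E} {t : ℝ} (he : HasDerivAt e e' t)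
    (hw : HasDerivAt w (-(mu • A (e t)) - (lam / 2) • w t) t) :
    HasDerivAt (fun s => (1 / 2) * ⟪e s, A (e s)⟫ + (1 / (2 * mu)) * ‖w s‖ ^ 2)
      (⟪e t, A (e' - w t)⟫ - (lam / (2 * mu)) * ‖w t‖ ^ 2) t := by
  have h := ((he.inner ℝ (A.hasFDerivAt.comp_hasDerivAt t he)).const_mul (1 / 2)).add
    (hw.norm_sq.const_mul (1 / (2 * mu)))
  refine h.congr_deriv ?_
  have h₁ : ⟪e', A (e t)⟫ = ⟪e t, A e'⟫ := by
    rw [real_inner_comm]; exact hA (e t) e'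
  have h₂ : ⟪w t, A (e t)⟫ = ⟪e t, A (w t)⟫ := by
    rw [real_inner_comm]; exact hA (e t) (w t)
  simp only [Function.comp_apply, map_sub, inner_sub_right, inner_neg_right,
    real_inner_smul_right, real_inner_self_eq_norm_sq, h₁, h₂]
  field_simp
  ring

theorem stmt_12 (H₀ : Matrix (Fin 3) (Fin 3) ℝ) (hH₀ : H₀.IsSymm)
    (m μ_v lam : ℝ) (hm : 0 < m) (hμv : 0 < μ_v)
    (r_d : EuclideanSpace ℝ (Fin 3))
    (vs : EuclideanSpace ℝ (Fin 3) → EuclideanSpace ℝ (Fin 3)) (hvs : Differentiable ℝ vs)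
    (C₁ C₂ : ℝ → (EuclideanSpace ℝ (Fin 3) →L[ℝ] EuclideanSpace ℝ (Fin 3)))
    (g : ℝ → EuclideanSpace ℝ (Fin 3))
    (r v u_ref : ℝ → EuclideanSpace ℝ (Fin 3))
    (hr : Differentiable ℝ r) (hv : Differentiable ℝ v)
    (huref : ∀ t, u_ref t = m • (C₁ t (v t) + C₂ t (r t) - g t
      + fderiv ℝ vs (r t) (v t)
      - μ_v • (Matrix.toEuclideanLin H₀ (r t - r_d))
      - (lam / 2) • (v t - vs (r t))))
    (hrd : ∀ t, deriv r t = v t)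
    (hvd : ∀ t, deriv v t = -(C₁ t (v t)) - C₂ t (r t) + g t + (1 / m) • u_ref t) :
    Differentiable ℝ (fun t =>
      (1 / 2) * ⟪r t - r_d, Matrix.toEuclideanLin H₀ (r t - r_d)⟫
        + (1 / (2 * μ_v)) * ‖v t - vs (r t)‖ ^ 2) ∧
    ∀ t, deriv (fun t =>
      (1 / 2) * ⟪r t - r_d, Matrix.toEuclideanLin H₀ (r t - r_d)⟫
        + (1 / (2 * μ_v)) * ‖v t - vs (r t)‖ ^ 2) t =
      ⟪r t - r_d, Matrix.toEuclideanLin H₀ (vs (r t))⟫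
        - (lam / (2 * μ_v)) * ‖v t - vs (r t)‖ ^ 2 := by
  have hA : (Matrix.toEuclideanLin H₀).IsSymmetric := by
    rw [Matrix.isSymmetric_toEuclideanLin_iff, Matrix.IsHermitian,
      Matrix.conjTranspose_eq_transpose_of_trivial]
    exact hH₀
  have key (t : ℝ) : HasDerivAt (fun t =>
      (1 / 2) * ⟪r t - r_d, Matrix.toEuclideanLin H₀ (r t - r_d)⟫
        + (1 / (2 * μ_v)) * ‖v t - vs (r t)‖ ^ 2)
      (⟪r t - r_d, Matrix.toEuclideanLin H₀ (vs (r t))⟫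
        - (lam / (2 * μ_v)) * ‖v t - vs (r t)‖ ^ 2) t := by
    have hr' : HasDerivAt r (v t) t := hrd t ▸ (hr t).hasDerivAt
    have hw : HasDerivAt (fun s => v s - vs (r s))
        (-(μ_v • Matrix.toEuclideanLin H₀ (r t - r_d)) - (lam / 2) • (v t - vs (r t))) t := by
      refine ((hv t).hasDerivAt.sub
        ((hvs (r t)).hasFDerivAt.comp_hasDerivAt t hr')).congr_deriv ?_
      rw [hvd, huref, smul_smul, one_div_mul_cancel hm.ne', one_smul]
      abel
    have h := hasDerivAt_backstepping_energy
      (A := LinearMap.toContinuousLinearMap (Matrix.toEuclideanLin H₀)) hA hμv.ne'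
      (hr'.sub_const r_d) hw
    simpa only [LinearMap.coe_toContinuousLinearMap', sub_sub_cancel] using h
  exact ⟨fun t => (key t).differentiableAt, fun t => (key t).deriv⟩
end

section
/- Let E = ℝ³ with the Euclidean inner product, and let v_max > 0, k_p > 0, h₀ > 0, λ > 0, μ_v > 0, m > 0, R > 0 and r_d ∈ E. Define the saturated reference velocity field v_s : E → E componentwise by v_s(x)_i = −v_max·tanh((x_i − (r_d)_i)/k_p) for i = 1,2,3 (which is differentiable with Fréchet derivative Dv_s). Let C₁, C₂ : ℝ → (E →L E) be time-varying linear maps, g : ℝ → E a function, and let r, v : ℝ → E be differentiable with r′(t) = v(t) and v′(t) = −C₁(t)(v(t)) − C₂(t)(r(t)) + g(t) + (1/m)·u_ref(t), where u_ref(t) := m·(C₁(t)(v(t)) + C₂(t)(r(t)) − g(t) + Dv_s(r(t))(v(t)) − μ_v·h₀·(r(t) − r_d) − (λ/2)·(v(t) − v_s(r(t)))). Define V₁(t) := (h₀/2)·‖r(t) − r_d‖² + (1/(2μ_v))·‖v(t) − v_s(r(t))‖² and σ := min (2·v_max·tanh(R/k_p)/R) λ. If |r(t)_i − (r_d)_i|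 ≤ R for all t ≥ 0 and i = 1,2,3, then V₁′(t) ≤ −σ·V₁(t) for all t ≥ 0, and consequently V₁(t) ≤ V₁(0)·exp(−σ·t) for all t ≥ 0; in particular r(t) → r_d and v(t) − v_s(r(t)) → 0 as t → ∞. -/
open RealInnerProductSpace Filter

theorem hasDerivAt_real_tanh (x : ℝ) : HasDerivAt Real.tanh (1 / Real.cosh x ^ 2) x := by
  have h := (Real.hasDerivAt_sinh x).div (Real.hasDerivAt_cosh x) (Real.cosh_pos x).ne'
  have heq : Real.tanh = Real.sinh / Real.cosh := by
    funext y
    simp [Real.tanh_eq_sinh_div_cosh]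
  rw [heq]
  refine h.congr_deriv ?_
  rw [← sq, ← sq, Real.cosh_sq_sub_sinh_sq]

theorem differentiable_real_tanh : Differentiable ℝ Real.tanh :=
  fun x => (hasDerivAt_real_tanh x).differentiableAt

theorem concaveOn_real_tanh : ConcaveOn ℝ (Set.Ici 0) Real.tanh := by
  refine AntitoneOn.concaveOn_of_deriv (convex_Ici 0)
    differentiable_real_tanh.continuous.continuousOn
    differentiable_real_tanh.differentiableOn ?_
  intro x hx y hy hxy
  rw [interior_Ici, Set.mem_Ioi] at hx hy
  rw [(hasDerivAt_real_tanh x).deriv, (hasDerivAt_real_tanh y).deriv]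
  have hcosh : Real.cosh x ≤ Real.cosh y := by
    rwa [Real.cosh_le_cosh, abs_of_pos hx, abs_of_pos hy]
  have := Real.cosh_pos x
  gcongr

theorem real_tanh_pos {x : ℝ} (hx : 0 < x) : 0 < Real.tanh x := by
  rw [Real.tanh_eq_sinh_div_cosh]
  exact div_pos (Real.sinh_pos_iff.2 hx) (Real.cosh_pos x)

/-- On `[-R, R]` the function `tanh (· / k)` lies beyond its chord of slope `tanh (R / k) / R`. -/
theorem tanh_div_mul_sq_le_mul_tanh {k R x : ℝ} (hk : 0 < k) (hR : 0 < R) (hx : |x| ≤ R) :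
    Real.tanh (R / k) / R * x ^ 2 ≤ x * Real.tanh (x / k) := by
  have key : ∀ y, 0 ≤ y → y ≤ R →
      Real.tanh (R / k) / R * y ^ 2 ≤ y * Real.tanh (y / k) := by
    intro y hy hyR
    have h := concaveOn_real_tanh.2 Set.self_mem_Ici (Set.mem_Ici.2 (div_pos hR hk).le)
      (sub_nonneg.2 ((div_le_one hR).2 hyR)) (div_nonneg hy hR.le) (sub_add_cancel 1 (y / R))
    have harg : y / R * (R / k) = y / k := by field_simp
    simp only [smul_eq_mul, mul_zero, Real.tanh_zero, zero_add, harg] at h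
    calc Real.tanh (R / k) / R * y ^ 2 = y * (y / R * Real.tanh (R / k)) := by ring
      _ ≤ y * Real.tanh (y / k) := by gcongr
  rcases le_total 0 x with h0 | h0
  · exact key x h0 (by rwa [abs_of_nonneg h0] at hx)
  · have h := key (-x) (by linarith) (by rwa [abs_of_nonpos h0] at hx)
    simpa [neg_div, Real.tanh_neg] using h

/-- The differential inequality `V' ≤ -σ V` on `[0, ∞)` forces exponential decay. -/
theorem le_mul_exp_of_deriv_le_neg_mul {V : ℝ → ℝ} {σ : ℝ} (hV : Differentiable ℝ V)
    (h : ∀ t, 0 ≤ t → deriv V t ≤ -σ * V t) {t : ℝ} (ht : 0 ≤ t) :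
    V t ≤ V 0 * Real.exp (-σ * t) := by
  have hderiv (s : ℝ) : HasDerivAt (fun s => V s * Real.exp (σ * s))
      ((deriv V s + σ * V s) * Real.exp (σ * s)) s := by
    have hexp : HasDerivAt (fun s => Real.exp (σ * s)) (Real.exp (σ * s) * (σ * 1)) s :=
      ((hasDerivAt_id s).const_mul σ).exp
    exact ((hV s).hasDerivAt.mul hexp).congr_deriv (by ring)
  have hanti : AntitoneOn (fun s => V s * Real.exp (σ * s)) (Set.Ici 0) := by
    refine antitoneOn_of_deriv_nonpos (convex_Ici 0)
      (fun s _ => (hderiv s).continuousAt.continuousWithinAt)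
      (fun s _ => (hderiv s).differentiableAt.differentiableWithinAt) fun s hs => ?_
    rw [interior_Ici, Set.mem_Ioi] at hs
    rw [(hderiv s).deriv]
    exact mul_nonpos_of_nonpos_of_nonneg (by linarith [h s hs.le]) (Real.exp_pos _).le
  have h0 := hanti (Set.mem_Ici.2 le_rfl) (Set.mem_Ici.2 ht) ht
  simp only [mul_zero, Real.exp_zero, mul_one] at h0
  rw [neg_mul, Real.exp_neg, ← div_eq_mul_inv, le_div_iff₀ (Real.exp_pos _)]
  exact h0

theorem tendsto_zero_of_mul_norm_sq_le {E : Type*} [SeminormedAddCommGroup E] {f : ℝ → E}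
    {W : ℝ → ℝ} {c : ℝ} (hc : 0 < c) (h : ∀ᶠ t in atTop, c * ‖f t‖ ^ 2 ≤ W t)
    (hW : Tendsto W atTop (nhds 0)) : Tendsto f atTop (nhds 0) := by
  have hlim : Tendsto (fun t => √(W t / c)) atTop (nhds 0) := by
    simpa using (hW.div_const c).sqrt
  refine squeeze_zero_norm' ?_ hlim
  filter_upwards [h] with t ht
  refine Real.le_sqrt_of_sq_le ?_
  rw [le_div_iff₀ hc]
  linarith

section Saturation

variable {ι : Type*} [Fintype ι] {vs : EuclideanSpace ℝ ι → EuclideanSpace ℝ ι}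
  {r_d : EuclideanSpace ℝ ι} {v_max k_p : ℝ}

theorem differentiable_of_apply_eq_tanh
    (hvs : ∀ x i, vs x i = -v_max * Real.tanh ((x i - r_d i) / k_p)) :
    Differentiable ℝ vs := by
  rw [differentiable_euclidean]
  intro i
  simp only [hvs]
  refine (differentiable_real_tanh.comp ?_).const_mul _
  fun_prop

theorem inner_le_of_apply_eq_tanh {R : ℝ} (hvmax : 0 ≤ v_max) (hkp : 0 < k_p) (hR : 0 < R)
    (hvs : ∀ x i, vs x i = -v_max * Real.tanh ((x i - r_d i) / k_p))
    {x : EuclideanSpace ℝ ι} (hx : ∀ i, |x i - r_d i| ≤ R) :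
    ⟪x - r_d, vs x⟫ ≤ -(v_max * Real.tanh (R / k_p) / R) * ‖x - r_d‖ ^ 2 := by
  rw [EuclideanSpace.real_norm_sq_eq, PiLp.inner_apply, Finset.mul_sum]
  refine Finset.sum_le_sum fun i _ => ?_
  have h := mul_le_mul_of_nonneg_left (tanh_div_mul_sq_le_mul_tanh hkp hR (hx i)) hvmax
  simp only [hvs, PiLp.sub_apply, RCLike.inner_apply, conj_trivial]
  calc _ = -(v_max * ((x i - r_d i) * Real.tanh ((x i - r_d i) / k_p))) := by ring
    _ ≤ -(v_max * (Real.tanh (R / k_p) / R * (x i - r_d i) ^ 2)) := neg_le_neg h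
    _ = _ := by ring

end Saturation

theorem stmt_14 (v_max k_p h₀ lam μ_v m R : ℝ)
    (hvmax : 0 < v_max) (hkp : 0 < k_p) (hh₀ : 0 < h₀) (hlam : 0 < lam)
    (hμv : 0 < μ_v) (hm : 0 < m) (hR : 0 < R)
    (r_d : EuclideanSpace ℝ (Fin 3))
    (vs : EuclideanSpace ℝ (Fin 3) → EuclideanSpace ℝ (Fin 3))
    (hvs : ∀ (x : EuclideanSpace ℝ (Fin 3)) (i : Fin 3),
      vs x i = -v_max * Real.tanh ((x i - r_d i) / k_p))
    (C₁ C₂ : ℝ → (EuclideanSpace ℝ (Fin 3) →L[ℝ] EuclideanSpace ℝ (Fin 3)))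
    (g : ℝ → EuclideanSpace ℝ (Fin 3))
    (r v u_ref : ℝ → EuclideanSpace ℝ (Fin 3))
    (hr : Differentiable ℝ r) (hv : Differentiable ℝ v)
    (huref : ∀ t, u_ref t = m • (C₁ t (v t) + C₂ t (r t) - g t
      + fderiv ℝ vs (r t) (v t)
      - (μ_v * h₀) • (r t - r_d)
      - (lam / 2) • (v t - vs (r t))))
    (hrd : ∀ t, deriv r t = v t)
    (hvd : ∀ t, deriv v t = -(C₁ t (v t)) - C₂ t (r t) + g t + (1 / m) • u_ref t)
    (hbound : ∀ t : ℝ, 0 ≤ t → ∀ i : Fin 3, |r t i - r_d i| ≤ R) :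
    (∀ t : ℝ, 0 ≤ t →
      deriv (fun s => (h₀ / 2) * ‖r s - r_d‖ ^ 2
          + (1 / (2 * μ_v)) * ‖v s - vs (r s)‖ ^ 2) t ≤
        -(min (2 * v_max * Real.tanh (R / k_p) / R) lam) *
          ((h₀ / 2) * ‖r t - r_d‖ ^ 2 + (1 / (2 * μ_v)) * ‖v t - vs (r t)‖ ^ 2)) ∧
    (∀ t : ℝ, 0 ≤ t →
      (h₀ / 2) * ‖r t - r_d‖ ^ 2 + (1 / (2 * μ_v)) * ‖v t - vs (r t)‖ ^ 2 ≤
        ((h₀ / 2) * ‖r 0 - r_d‖ ^ 2 + (1 / (2 * μ_v)) * ‖v 0 - vs (r 0)‖ ^ 2) *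
          Real.exp (-(min (2 * v_max * Real.tanh (R / k_p) / R) lam) * t)) ∧
    Tendsto r atTop (nhds r_d) ∧
    Tendsto (fun t => v t - vs (r t)) atTop (nhds 0) := by
  have hvsd := differentiable_of_apply_eq_tanh hvs
  have hz (t : ℝ) : HasDerivAt (fun s => v s - vs (r s))
      (-((μ_v * h₀) • (r t - r_d)) - (lam / 2) • (v t - vs (r t))) t := by
    have hcomp := (hvsd (r t)).hasFDerivAt.comp_hasDerivAt t (hr t).hasDerivAt
    refine ((hv t).hasDerivAt.sub hcomp).congr_deriv ?_
    rw [hvd, huref, smul_smul, one_div_mul_cancel hm.ne', one_smul, hrd]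
    abel
  have hV (t : ℝ) : HasDerivAt (fun s => (h₀ / 2) * ‖r s - r_d‖ ^ 2
      + (1 / (2 * μ_v)) * ‖v s - vs (r s)‖ ^ 2)
      (h₀ * ⟪r t - r_d, vs (r t)⟫ - lam / (2 * μ_v) * ‖v t - vs (r t)‖ ^ 2) t := by
    refine ((((hr t).hasDerivAt.sub_const r_d).norm_sq.const_mul (h₀ / 2)).add
      ((hz t).norm_sq.const_mul (1 / (2 * μ_v)))).congr_deriv ?_
    have hsplit : ⟪r t - r_d, v t⟫
        = ⟪r t - r_d, vs (r t)⟫ + ⟪v t - vs (r t), r t - r_d⟫ := by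
      rw [real_inner_comm (r t - r_d) (v t - vs (r t)), ← inner_add_right]
      simp
    rw [hrd, hsplit, inner_sub_right _ (-((μ_v * h₀) • (r t - r_d))), inner_neg_right,
      inner_smul_right, inner_smul_right, real_inner_self_eq_norm_sq]
    field_simp
    ring
  set σ := min (2 * v_max * Real.tanh (R / k_p) / R) lam with hσ
  have hσpos : 0 < σ := by
    have := real_tanh_pos (div_pos hR hkp)
    exact lt_min (by positivity) hlam
  have hdecay : ∀ t : ℝ, 0 ≤ t →
      deriv (fun s => (h₀ / 2) * ‖r s - r_d‖ ^ 2
          + (1 / (2 * μ_v)) * ‖v s - vs (r s)‖ ^ 2) t ≤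
        -σ * ((h₀ / 2) * ‖r t - r_d‖ ^ 2 + (1 / (2 * μ_v)) * ‖v t - vs (r t)‖ ^ 2) := by
    intro t ht
    rw [(hV t).deriv]
    have hinner := mul_le_mul_of_nonneg_left
      (inner_le_of_apply_eq_tanh hvmax.le hkp hR hvs (hbound t ht)) hh₀.le
    have hpos : σ * ((h₀ / 2) * ‖r t - r_d‖ ^ 2)
        ≤ 2 * v_max * Real.tanh (R / k_p) / R * ((h₀ / 2) * ‖r t - r_d‖ ^ 2) := by
      gcongr
      exact min_le_left _ _
    have hvel : σ * ((1 / (2 * μ_v)) * ‖v t - vs (r t)‖ ^ 2)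
        ≤ lam * ((1 / (2 * μ_v)) * ‖v t - vs (r t)‖ ^ 2) := by
      gcongr
      exact min_le_right _ _
    linear_combination hinner + hpos + hvel
  have hexp := fun (t : ℝ) (ht : 0 ≤ t) =>
    le_mul_exp_of_deriv_le_neg_mul (fun s => (hV s).differentiableAt) hdecay ht
  have hlim : Tendsto (fun t => ((h₀ / 2) * ‖r 0 - r_d‖ ^ 2
      + (1 / (2 * μ_v)) * ‖v 0 - vs (r 0)‖ ^ 2) * Real.exp (-σ * t)) atTop (nhds 0) := by
    simpa using (Real.tendsto_exp_atBot.comp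
      (tendsto_id.const_mul_atTop_of_neg (neg_lt_zero.2 hσpos))).const_mul
        ((h₀ / 2) * ‖r 0 - r_d‖ ^ 2 + (1 / (2 * μ_v)) * ‖v 0 - vs (r 0)‖ ^ 2)
  refine ⟨hdecay, hexp, ?_, ?_⟩
  · refine tendsto_sub_nhds_zero_iff.1
      (tendsto_zero_of_mul_norm_sq_le (half_pos hh₀) ?_ hlim)
    filter_upwards [eventually_ge_atTop 0] with t ht
    exact (le_add_of_nonneg_right (by positivity)).trans (hexp t ht)
  · refine tendsto_zero_of_mul_norm_sq_le (c := 1 / (2 * μ_v)) (by positivity) ?_ hlim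
    filter_upwards [eventually_ge_atTop 0] with t ht
    exact (le_add_of_nonneg_left (by positivity)).trans (hexp t ht)
end
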